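/- If E is a preferred extension of the sequent-based ABA-framework, then there is some T ∈ MCS(S,A) such that E = Arg_seq(S,T), the set of all assumptive sequent arguments whose assumptions are contained in T and whose supports are contained in S. -/

import Mathlib

/-- A rule `φ₁,…,φₙ → φ` of a deductive system: premises and a conclusion. -/
abbrev Rule (F : Type) := List F × F

/-- Deducibility `Γ ⊢^R φ`: chaining rules of `R` from members of `Γ`. -/
inductive Ded {F : Type} (R : Set (Rule F)) (Γ : Set F) : F → Prop
  | mem {φ : F} : φ ∈ Γ → Ded R Γ φ
  | app {l : List F} {φ : F} : (l, φ) ∈ R → (∀ ψ ∈ l, Ded R Γ ψ) → Ded R Γ φ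

/-- Derivability of assumptive sequents `A' ⟨ Γ ⇒ Δ` in the calculus `R_⇒`:
the sequents `μ(r)` for `r ∈ R`, the identity axiom, the two cut rules, and the
rules `AS_ABA` moving a formula of the assumption set `AS` between the
assumption component and the left-hand side of `⇒`. -/
inductive SeqDer {F : Type} [DecidableEq F] (R : Set (Rule F)) (AS : Set F) :
    Finset F → Finset F → Finset F → Prop
  | id (φ : F) : SeqDer R AS ∅ {φ} {φ}
  | mu {l : List F} {φ : F} : (l, φ) ∈ R → SeqDer R AS ∅ l.toFinset {φ}
  | cutLhs {A₁ A₂ Γ₁ Γ₂ Δ₁ Δ₂ : Finset F} {φ : F} :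
      SeqDer R AS A₁ Γ₁ (insert φ Δ₁) → SeqDer R AS A₂ (insert φ Γ₂) Δ₂ →
      SeqDer R AS (A₁ ∪ A₂) (Γ₁ ∪ Γ₂) (Δ₁ ∪ Δ₂)
  | cutAss {A₁ A₂ Γ₁ Γ₂ Δ₁ Δ₂ : Finset F} {φ : F} :
      SeqDer R AS A₁ Γ₁ (insert φ Δ₁) → SeqDer R AS (insert φ A₂) Γ₂ Δ₂ →
      SeqDer R AS (A₁ ∪ A₂) (Γ₁ ∪ Γ₂) (Δ₁ ∪ Δ₂)
  | toAss {A' Γ Δ : Finset F} {φ : F} :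
      φ ∈ AS → SeqDer R AS A' (insert φ Γ) Δ → SeqDer R AS (insert φ A') Γ Δ
  | toLhs {A' Γ Δ : Finset F} {φ : F} :
      φ ∈ AS → SeqDer R AS (insert φ A') Γ Δ → SeqDer R AS A' (insert φ Γ) Δ

/-- An argument: an assumption component, a support (strict premises) and a conclusion. -/
structure Argu (F : Type) where
  ass : Finset F
  supp : Finset F
  concl : F

/-- `a` is an ABA-argument based on `S` and `A`: a deduction `ass(a) ∪ supp(a) ⊢^R conc(a)`
with finite `ass(a) ⊆ A` and finite `supp(a) ⊆ S`. -/
def IsABAArg {F : Type} (R : Set (Rule F)) (S A : Set F) (a : Argu F) : Prop :=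
  ↑a.ass ⊆ A ∧ ↑a.supp ⊆ S ∧ Ded R (↑a.ass ∪ ↑a.supp) a.concl

/-- `a` is an assumptive sequent argument based on `S` and `A`: a sequent
`ass(a) ⟨ supp(a) ⇒ conc(a)` derivable in `R_⇒`, with `ass(a) ⊆ A` and `supp(a) ⊆ S`. -/
def IsSeqArg {F : Type} [DecidableEq F] (R : Set (Rule F)) (S A : Set F) (a : Argu F) : Prop :=
  ↑a.ass ⊆ A ∧ ↑a.supp ⊆ S ∧ SeqDer R A a.ass a.supp {a.concl}

/-- `a` attacks `b` iff the conclusion of `a` is the contrary of some assumption of `b`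
(this is the ABA attack, and also the sequent-based `AT_ABA` attack). -/
def Attacks {F : Type} (contrary : F → F) (a b : Argu F) : Prop :=
  ∃ ψ ∈ b.ass, a.concl = contrary ψ

/-- `E` is conflict-free: a set of arguments of the framework no member of which attacks a member. -/
def ConflictFree {α : Type} (Args : Set α) (att : α → α → Prop) (E : Set α) : Prop :=
  E ⊆ Args ∧ ∀ a ∈ E, ∀ b ∈ E, ¬ att a b

/-- `E` defends `a`: `E` attacks every attacker of `a`. -/
def Defends {α : Type} (Args : Set α) (att : α → α → Prop) (E : Set α) (a : α) : Prop :=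
  ∀ b ∈ Args, att b a → ∃ c ∈ E, att c b

/-- `E` is admissible: conflict-free and defending all of its elements. -/
def Admissible {α : Type} (Args : Set α) (att : α → α → Prop) (E : Set α) : Prop :=
  ConflictFree Args att E ∧ ∀ a ∈ E, Defends Args att E a

/-- A complete extension: an admissible set containing every argument it defends. -/
def CompleteExt {α : Type} (Args : Set α) (att : α → α → Prop) (E : Set α) : Prop :=
  Admissible Args att E ∧ ∀ a ∈ Args, Defends Args att E a → a ∈ E

/-- The grounded extension: the ⊆-minimal complete extension. -/
def GroundedExt {α : Type} (Args : Set α) (att : α → α → Prop) (E : Set α) : Prop :=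
  CompleteExt Args att E ∧ ∀ E', CompleteExt Args att E' → E ⊆ E'

/-- A preferred extension: a ⊆-maximal complete extension. -/
def PreferredExt {α : Type} (Args : Set α) (att : α → α → Prop) (E : Set α) : Prop :=
  CompleteExt Args att E ∧ ∀ E', CompleteExt Args att E' → E ⊆ E' → E' = E

/-- A set `A'` of assumptions is consistent iff there is no `φ ∈ A'` with
`A'' ∪ Γ ⊢^R φ̄` for some `A'' ⊆ A'` and `Γ ⊆ S`. -/
def ConsistentSet {F : Type} (R : Set (Rule F)) (contrary : F → F) (S : Set F)
    (A' : Set F) : Prop :=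
  ¬ ∃ φ ∈ A', ∃ A'' ⊆ A', ∃ Γ ⊆ S, Ded R (A'' ∪ Γ) (contrary φ)

/-- `MCS(S,A)`: the set of ⊆-maximal consistent subsets of `A`. -/
def MCS {F : Type} (R : Set (Rule F)) (contrary : F → F) (S A : Set F) : Set (Set F) :=
  {T | T ⊆ A ∧ ConsistentSet R contrary S T ∧
    ∀ T', T ⊆ T' → T' ⊆ A → ConsistentSet R contrary S T' → T' = T}

/-- `CN(T) = {φ | Γ ⊢^R φ for some Γ ⊆ T}`. -/
def CN {F : Type} (R : Set (Rule F)) (T : Set F) : Set F :=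
  {φ | ∃ Γ ⊆ T, Ded R Γ φ}

/-- `⊢^R` is contrapositive for assumptions: for all `φ, ψ` in an assumption set `A'`
and `Γ ⊆ S`, `A' ∪ Γ ⊢^R ψ̄` iff `(A' \ {φ}) ∪ {ψ} ∪ Γ ⊢^R φ̄`. -/
def Contrapositive {F : Type} (R : Set (Rule F)) (contrary : F → F) (S A : Set F) : Prop :=
  ∀ A' ⊆ A, ∀ Γ ⊆ S, ∀ φ ∈ A', ∀ ψ ∈ A',
    (Ded R (A' ∪ Γ) (contrary ψ) ↔ Ded R ((A' \ {φ}) ∪ {ψ} ∪ Γ) (contrary φ))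

theorem Ded.mono {F : Type} {R : Set (Rule F)} {Γ Γ' : Set F} {φ : F} (h : Γ ⊆ Γ')
    (d : Ded R Γ φ) : Ded R Γ' φ := by
  induction d with
  | mem hm => exact .mem (h hm)
  | app hr _ ih => exact .app hr ih

theorem Ded.trans {F : Type} {R : Set (Rule F)} {Γ Γ' : Set F} {φ : F}
    (h : ∀ ψ ∈ Γ, Ded R Γ' ψ) (d : Ded R Γ φ) : Ded R Γ' φ := by
  induction d with
  | mem hm => exact h _ hm
  | app hr _ ih => exact .app hr ih

/-- Soundness of the sequent calculus: every formula on the right-hand side of a derivable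
sequent is deducible from its assumptions and its left-hand side. -/
theorem SeqDer.ded {F : Type} [DecidableEq F] {R : Set (Rule F)} {AS : Set F}
    {A' Γ Δ : Finset F} (h : SeqDer R AS A' Γ Δ) :
    ∀ δ ∈ Δ, Ded R (↑A' ∪ ↑Γ) δ := by
  induction h with
  | id φ => exact fun δ hδ => .mem (by simpa using hδ)
  | @mu l φ hr =>
    intro δ hδ
    obtain rfl : δ = φ := by simpa using hδ
    exact .app hr fun ψ hψ => .mem (by simpa using hψ)
  | @cutLhs A₁ A₂ Γ₁ Γ₂ Δ₁ Δ₂ φ _ _ ih₁ ih₂ =>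
    have hm : (A₁ ∪ Γ₁ : Set F) ⊆ ↑(A₁ ∪ A₂) ∪ ↑(Γ₁ ∪ Γ₂) := by intro x; simp; tauto
    intro δ hδ
    rcases Finset.mem_union.1 hδ with hδ | hδ
    · exact (ih₁ δ (by simp [hδ])).mono hm
    · refine (ih₂ δ hδ).trans fun ψ hψ => ?_
      by_cases hψφ : ψ = φ
      · exact hψφ ▸ (ih₁ φ (by simp)).mono hm
      · exact .mem (by simp at hψ ⊢; tauto)
  | @cutAss A₁ A₂ Γ₁ Γ₂ Δ₁ Δ₂ φ _ _ ih₁ ih₂ =>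
    have hm : (A₁ ∪ Γ₁ : Set F) ⊆ ↑(A₁ ∪ A₂) ∪ ↑(Γ₁ ∪ Γ₂) := by intro x; simp; tauto
    intro δ hδ
    rcases Finset.mem_union.1 hδ with hδ | hδ
    · exact (ih₁ δ (by simp [hδ])).mono hm
    · refine (ih₂ δ hδ).trans fun ψ hψ => ?_
      by_cases hψφ : ψ = φ
      · exact hψφ ▸ (ih₁ φ (by simp)).mono hm
      · exact .mem (by simp at hψ ⊢; tauto)
  | toAss _ _ ih =>
    exact fun δ hδ => (ih δ hδ).mono (by intro x; simp; tauto)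
  | toLhs _ _ ih =>
    exact fun δ hδ => (ih δ hδ).mono (by intro x; simp; tauto)

theorem SeqDer.exists_of_forall_cut {F : Type} [DecidableEq F] {R : Set (Rule F)}
    {AS A' S' : Set F} {φ : F} (L : Finset F)
    (hL : ∀ ψ ∈ L, ∃ B G : Finset F, ↑B ⊆ A' ∧ ↑G ⊆ S' ∧ SeqDer R AS B G {ψ}) :
    ∀ B G : Finset F, ↑B ⊆ A' → ↑G ⊆ S' → SeqDer R AS B (L ∪ G) {φ} →
      ∃ B G : Finset F, ↑B ⊆ A' ∧ ↑G ⊆ S' ∧ SeqDer R AS B G {φ} := by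
  induction L using Finset.induction_on with
  | empty => exact fun B G hB hG d => ⟨B, G, hB, hG, by simpa using d⟩
  | insert ψ L _ ih =>
    intro B G hB hG d
    obtain ⟨B', G', hB', hG', d'⟩ := hL ψ (by simp)
    have hcut : SeqDer R AS (B' ∪ B) (G' ∪ (L ∪ G)) (∅ ∪ {φ}) :=
      .cutLhs (φ := ψ) (by simpa using d') (by simpa [Finset.insert_union] using d)
    refine ih (fun χ hχ => hL χ (by simp [hχ])) (B' ∪ B) (G' ∪ G) (by simp [*]) (by simp [*]) ?_
    rw [Finset.union_left_comm]
    simpa using hcut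

theorem SeqDer.singleton_ass {F : Type} [DecidableEq F] {R : Set (Rule F)} {AS : Set F} {φ : F}
    (h : φ ∈ AS) : SeqDer R AS {φ} ∅ {φ} :=
  .toAss (A' := ∅) (Γ := ∅) h (.id φ)

/-- Completeness of the sequent calculus, up to dropping unused premises. -/
theorem Ded.exists_seqDer {F : Type} [DecidableEq F] {R : Set (Rule F)} {AS A' S' : Set F}
    {φ : F} (hA' : A' ⊆ AS) (d : Ded R (A' ∪ S') φ) :
    ∃ B G : Finset F, ↑B ⊆ A' ∧ ↑G ⊆ S' ∧ SeqDer R AS B G {φ} := by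
  induction d with
  | @mem φ h =>
    rcases h with h | h
    · exact ⟨{φ}, ∅, by simpa using h, by simp, .singleton_ass (hA' h)⟩
    · exact ⟨∅, {φ}, by simp, by simpa using h, .id φ⟩
  | @app l φ hr _ ih =>
    exact SeqDer.exists_of_forall_cut l.toFinset (fun ψ hψ => ih ψ (by simpa using hψ)) ∅ ∅
      (by simp) (by simp) (by simpa using .mu hr)

theorem IsSeqArg.ded {F : Type} [DecidableEq F] {R : Set (Rule F)} {S A T : Set F} {a : Argu F}
    (ha : IsSeqArg R S A a) (hT : ↑a.ass ⊆ T) : Ded R (T ∪ S) a.concl :=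
  (ha.2.2.ded _ (by simp)).mono (Set.union_subset_union hT ha.2.1)

theorem Ded.exists_isSeqArg {F : Type} [DecidableEq F] {R : Set (Rule F)} {S A T : Set F} {φ : F}
    (hT : T ⊆ A) (d : Ded R (T ∪ S) φ) :
    ∃ a : Argu F, IsSeqArg R S A a ∧ ↑a.ass ⊆ T ∧ a.concl = φ := by
  obtain ⟨B, G, hB, hG, h⟩ := d.exists_seqDer hT
  exact ⟨⟨B, G, φ⟩, ⟨hB.trans hT, hG, h⟩, hB, rfl⟩

theorem consistentSet_iff {F : Type} {R : Set (Rule F)} {contrary : F → F} {S T : Set F} :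
    ConsistentSet R contrary S T ↔ ∀ φ ∈ T, ¬ Ded R (T ∪ S) (contrary φ) := by
  constructor
  · exact fun h φ hφ d => h ⟨φ, hφ, T, subset_rfl, S, subset_rfl, d⟩
  · rintro h ⟨φ, hφ, B, hB, G, hG, d⟩
    exact h φ hφ (d.mono (Set.union_subset_union hB hG))

theorem ConsistentSet.exists_mcs {F : Type} {R : Set (Rule F)} {contrary : F → F} {S A T : Set F}
    (hT : ConsistentSet R contrary S T) (hTA : T ⊆ A) : ∃ M ∈ MCS R contrary S A, T ⊆ M := by
  classical
  obtain ⟨M, hTM, hM⟩ := zorn_subset_nonempty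
    {T | T ⊆ A ∧ ConsistentSet R contrary S T} (fun c hc hchain hne => by
      refine ⟨⋃₀ c, ⟨Set.sUnion_subset fun t ht => (hc ht).1, ?_⟩,
        fun t ht => Set.subset_sUnion_of_mem ht⟩
      rw [consistentSet_iff]
      rintro φ ⟨t, ht, hφ⟩ d
      obtain ⟨B, G, hB, hG, hd⟩ := d.exists_seqDer subset_rfl
      obtain ⟨u, hu, hBu⟩ := hchain.directedOn.exists_mem_subset_of_finite_of_subset_sUnion
        hne B.finite_toSet hB
      obtain ⟨v, hv, htv, huv⟩ := hchain.directedOn t ht u hu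
      exact consistentSet_iff.1 (hc hv).2 φ (htv hφ) ((hd.ded _ (by simp)).mono
        (Set.union_subset_union (hBu.trans huv) hG))) T ⟨hTA, hT⟩
  exact ⟨M, ⟨hM.prop.1, hM.prop.2, fun T' h h₁ h₂ => (hM.eq_of_subset ⟨h₁, h₂⟩ h).symm⟩, hTM⟩

/-- A nonempty maximal consistent set refutes every assumption outside of it. -/
theorem Contrapositive.ded_contrary_of_notMem {F : Type} {R : Set (Rule F)} {contrary : F → F}
    {S A T : Set F} {χ : F} (hcp : Contrapositive R contrary S A) (hT : T ∈ MCS R contrary S A)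
    (hne : T.Nonempty) (hχA : χ ∈ A) (hχ : χ ∉ T) : Ded R (T ∪ S) (contrary χ) := by
  have hins : insert χ T ⊆ A := Set.insert_subset hχA hT.1
  have hdiff (φ) (hφ : φ ∈ T) (d : Ded R (insert χ T ∪ S) (contrary φ)) :
      Ded R (T ∪ S) (contrary χ) := by
    refine ((hcp _ hins S subset_rfl χ (by simp) φ (by simp [hφ])).1 d).mono ?_
    rintro x ((⟨hx | hx, hxχ⟩ | rfl) | hx)
    · exact absurd hx hxχ
    · exact .inl hx
    · exact .inl hφ
    · exact .inr hx
  have hincons : ¬ ConsistentSet R contrary S (insert χ T) := fun hc =>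
    hχ (hT.2.2 _ (Set.subset_insert _ _) hins hc ▸ Set.mem_insert χ T)
  rw [consistentSet_iff] at hincons
  push Not at hincons
  obtain ⟨φ, rfl | hφ, d⟩ := hincons
  · obtain ⟨ψ, hψ⟩ := hne
    refine hdiff ψ hψ (((hcp _ hins S subset_rfl ψ (by simp [hψ]) φ (by simp)).1 d).mono ?_)
    rintro x ((⟨hx, -⟩ | rfl) | hx)
    · exact .inl hx
    · exact .inl (by simp)
    · exact .inr hx
  · exact hdiff φ hφ d

theorem completeExt_of_mem_mcs {F : Type} [DecidableEq F] {R : Set (Rule F)} {contrary : F → F}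
    {S A T : Set F} (hcp : Contrapositive R contrary S A) (hT : T ∈ MCS R contrary S A)
    (hne : T.Nonempty) :
    CompleteExt {a | IsSeqArg R S A a} (Attacks contrary)
      {a | IsSeqArg R S A a ∧ (a.ass : Set F) ⊆ T} := by
  have hcons := consistentSet_iff.1 hT.2.1
  have hcf : ∀ a : Argu F, IsSeqArg R S A a → ↑a.ass ⊆ T →
      ∀ ψ ∈ T, a.concl ≠ contrary ψ :=
    fun a ha haT ψ hψ h => hcons ψ hψ (h ▸ ha.ded haT)
  have hatt : ∀ b : Argu F, IsSeqArg R S A b → ¬ ↑b.ass ⊆ T →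
      ∃ c ∈ {a | IsSeqArg R S A a ∧ (a.ass : Set F) ⊆ T}, Attacks contrary c b := by
    intro b hb hbT
    obtain ⟨χ, hχb, hχ⟩ := Set.not_subset.1 hbT
    obtain ⟨c, hc, hcT, hcc⟩ :=
      (hcp.ded_contrary_of_notMem hT hne (hb.1 hχb) hχ).exists_isSeqArg hT.1
    exact ⟨c, ⟨hc, hcT⟩, χ, hχb, hcc⟩
  refine ⟨⟨⟨fun a ha => ha.1, ?_⟩, ?_⟩, ?_⟩
  · rintro a ⟨ha, haT⟩ b ⟨-, hbT⟩ ⟨ψ, hψ, h⟩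
    exact hcf a ha haT ψ (hbT hψ) h
  · rintro a ⟨-, haT⟩ b hb ⟨ψ, hψ, h⟩
    exact hatt b hb fun hbT => hcf b hb hbT ψ (haT hψ) h
  · refine fun a ha hdef => ⟨ha, by_contra fun haT => ?_⟩
    obtain ⟨c, hc, hca⟩ := hatt a ha haT
    obtain ⟨e, ⟨he, heT⟩, ψ, hψ, h⟩ := hdef c hc.1 hca
    exact hcf e he heT ψ (hc.2 hψ) h

/-- A complete extension consists of all arguments whose assumptions occur in it. -/
theorem CompleteExt.eq_setOf_ass_subset {F : Type} [DecidableEq F] {R : Set (Rule F)}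
    {contrary : F → F} {S A : Set F} {E : Set (Argu F)}
    (hE : CompleteExt {a | IsSeqArg R S A a} (Attacks contrary) E) :
    E = {a | IsSeqArg R S A a ∧ (a.ass : Set F) ⊆ ⋃ e ∈ E, ↑e.ass} := by
  refine Set.Subset.antisymm
    (fun a ha => ⟨hE.1.1.1 ha, Set.subset_biUnion_of_mem (u := fun e : Argu F => (e.ass : Set F)) ha⟩)
    ?_
  rintro a ⟨ha, haT⟩
  refine hE.2 a ha fun b hb ⟨ψ, hψ, h⟩ => ?_
  obtain ⟨e, he, hψe⟩ := Set.mem_iUnion₂.1 (haT hψ)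
  exact hE.1.2 e he b hb ⟨ψ, hψe, h⟩

/-- Lemma 4.19: assuming `⊢^R` is contrapositive for assumptions, if `E` is a preferred
extension of the sequent-based ABA-framework, then there is some `T ∈ MCS(S,A)` such
that `E = Arg_seq(S,T)`, the set of all assumptive sequent arguments whose assumptions
are contained in `T` and whose supports are contained in `S`. -/
theorem stmt9 {F V : Type} [DecidableEq F]
    (R : Set (Rule F)) (S A : Set F) (contrary : F → F) (atoms : F → Set V)
    (hA : A.Nonempty) (hSA : S ∩ A = ∅)
    (hNT : ∀ φ : F, (∀ s ∈ S, Disjoint (atoms φ) (atoms s)) → ¬ Ded R S φ)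
    (hcp : Contrapositive R contrary S A)
    (E : Set (Argu F))
    (hE : PreferredExt {a | IsSeqArg R S A a} (Attacks contrary) E) :
    ∃ T ∈ MCS R contrary S A,
      E = {a | IsSeqArg R S A a ∧ (a.ass : Set F) ⊆ T} := by
  have heq := hE.1.eq_setOf_ass_subset
  set T : Set F := ⋃ e ∈ E, ↑e.ass with hTdef
  have hTA : T ⊆ A := Set.iUnion₂_subset fun e he => (hE.1.1.1.1 he).1
  have hTc : ConsistentSet R contrary S T := by
    rw [consistentSet_iff]
    intro φ hφ d
    obtain ⟨e, he, hφe⟩ := Set.mem_iUnion₂.1 hφ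
    obtain ⟨a, ha, haT, hac⟩ := d.exists_isSeqArg hTA
    have haE : a ∈ E := by rw [heq]; exact ⟨ha, haT⟩
    exact hE.1.1.1.2 a haE e he ⟨φ, hφe, hac⟩
  refine ⟨T, ⟨hTA, hTc, fun T' hTT' hT'A hT'c => Set.Subset.antisymm (fun τ hτ => ?_) hTT'⟩, heq⟩
  obtain ⟨M, hM, hT'M⟩ := hT'c.exists_mcs hT'A
  have hEM : {a | IsSeqArg R S A a ∧ (a.ass : Set F) ⊆ M} = E :=
    hE.2 _ (completeExt_of_mem_mcs hcp hM ⟨τ, hT'M hτ⟩) fun a ha =>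
      ⟨hE.1.1.1.1 ha, (heq ▸ ha : a ∈ {a | _ ∧ _}).2.trans (hTT'.trans hT'M)⟩
  have hτE : (⟨{τ}, ∅, τ⟩ : Argu F) ∈ E := by
    rw [← hEM]
    exact ⟨⟨by simpa using hT'A hτ, by simp, .singleton_ass (hT'A hτ)⟩, by simpa using hT'M hτ⟩
  exact Set.mem_iUnion₂.2 ⟨_, hτE, by simp⟩
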